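/- Suppose the one-dimensional kinetic Fokker–Planck equation ∂_t f + v ∂_x f = ∂_v(σ ∂_v f + β v f) on (0,T)×(−1,1)×ℝ, with diffusion coefficient σ > 0 and friction coefficient β ≥ 0, initial datum f(0,x,v) = f₀(x,v), and inflow boundary condition f = g on the incoming boundary γ₋, admits a solution f whose restriction to K = [0,T]×[−1,1]×V, V = [−10,10], extends to a function of class C^{(1,1,2)} (all partial derivatives ∂_t^a ∂_x^b ∂_v^c with a ≤ 1, b ≤ 1, c ≤ 2 exist and are continuous) on an open neighborhood of K. Let σ̄ ∈ C³(ℝ) be any non-polynomial function. Then there exists a sequence (f_j) of one-hidden-layer neural networks, f_j(t,x,v) = Σ_{i=1}^{m_j} c_{j,i} σ̄(w_{j,i}·(t,x,v) + θ_{j,i}) with c_{j,i}, θ_{j,i} ∈ ℝ and w_{j,i} ∈ ℝ³, such that Loss_GE(f_j) + Loss_IC(f_j) + Loss_BC(f_j) → 0 as j → ∞. -/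

import Mathlib

open Real MeasureTheory Set Filter

/-- Partial derivative in the time variable. -/
noncomputable def Dt (f : ℝ → ℝ → ℝ → ℝ) : ℝ → ℝ → ℝ → ℝ :=
  fun t x v => deriv (fun s => f s x v) t

/-- Partial derivative in the space variable. -/
noncomputable def Dx (f : ℝ → ℝ → ℝ → ℝ) : ℝ → ℝ → ℝ → ℝ :=
  fun t x v => deriv (fun y => f t y v) x

/-- Partial derivative in the velocity variable. -/
noncomputable def Dv (f : ℝ → ℝ → ℝ → ℝ) : ℝ → ℝ → ℝ → ℝ :=
  fun t x v => deriv (fun w => f t x w) v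

/-- Mixed partial derivative ∂_t^a ∂_x^b ∂_v^c. -/
noncomputable def mixedD (a b c : ℕ) (f : ℝ → ℝ → ℝ → ℝ) : ℝ → ℝ → ℝ → ℝ :=
  Dt^[a] (Dx^[b] (Dv^[c] f))

/-- `f` is of class C^{(1,1,2)} on `U`: all mixed partial derivatives
∂_t^a ∂_x^b ∂_v^c with a ≤ 1, b ≤ 1, c ≤ 2 exist and are continuous on `U`. -/
def IsC112On (f : ℝ → ℝ → ℝ → ℝ) (U : Set (ℝ × ℝ × ℝ)) : Prop :=
  (∀ a b c : ℕ, a ≤ 1 → b ≤ 1 → c ≤ 2 → ∀ p ∈ U,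
    ContinuousAt (fun q : ℝ × ℝ × ℝ => mixedD a b c f q.1 q.2.1 q.2.2) p) ∧
  (∀ b c : ℕ, b ≤ 1 → c ≤ 2 → ∀ p ∈ U,
    DifferentiableAt ℝ (fun s => mixedD 0 b c f s p.2.1 p.2.2) p.1) ∧
  (∀ c : ℕ, c ≤ 2 → ∀ p ∈ U,
    DifferentiableAt ℝ (fun y => mixedD 0 0 c f p.1 y p.2.2) p.2.1) ∧
  (∀ c : ℕ, c ≤ 1 → ∀ p ∈ U,
    DifferentiableAt ℝ (fun w => mixedD 0 0 c f p.1 p.2.1 w) p.2.2)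

/-- The compact set K = [0,T] × [−1,1] × V with V = [−10,10]. -/
def Kset (T : ℝ) : Set (ℝ × ℝ × ℝ) :=
  Set.Icc (0 : ℝ) T ×ˢ Set.Icc (-1 : ℝ) 1 ×ˢ Set.Icc (-10 : ℝ) 10

/-- The Fokker–Planck residual ∂_t u + v ∂_x u − σ ∂_{vv} u − β ∂_v(v u). -/
noncomputable def FPresidual (σ β : ℝ) (u : ℝ → ℝ → ℝ → ℝ) : ℝ → ℝ → ℝ → ℝ :=
  fun t x v => Dt u t x v + v * Dx u t x v - σ * Dv (Dv u) t x v
    - β * Dv (fun t' x' w => w * u t' x' w) t x v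

/-- Loss for the governing equation. -/
noncomputable def LossGE (σ β T : ℝ) (u : ℝ → ℝ → ℝ → ℝ) : ℝ :=
  ∫ t in (0 : ℝ)..T, ∫ x in (-1 : ℝ)..(1 : ℝ), ∫ v in (-10 : ℝ)..(10 : ℝ),
    (FPresidual σ β u t x v) ^ 2

/-- Loss for the initial condition. -/
noncomputable def LossIC (f0 : ℝ → ℝ → ℝ) (u : ℝ → ℝ → ℝ → ℝ) : ℝ :=
  ∫ x in (-1 : ℝ)..(1 : ℝ), ∫ v in (-10 : ℝ)..(10 : ℝ), (u 0 x v - f0 x v) ^ 2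

/-- Loss for the inflow boundary condition with datum g. -/
noncomputable def LossBCinflow (T : ℝ) (g u : ℝ → ℝ → ℝ → ℝ) : ℝ :=
  ∫ t in (0 : ℝ)..T,
    ((∫ v in (-10 : ℝ)..(0 : ℝ), (u t 1 v - g t 1 v) ^ 2) +
     (∫ v in (0 : ℝ)..(10 : ℝ), (u t (-1) v - g t (-1) v) ^ 2))


section
open Real MeasureTheory Set Filter

lemma closed_integral_mem {𝕜 E α : Type*} [RCLike 𝕜] [NormedAddCommGroup E] [NormedSpace 𝕜 E] [NormedSpace ℝ E]
    [CompleteSpace E] [MeasurableSpace α] {μ : Measure α} (M : Submodule 𝕜 E) (hM : IsClosed (M : Set E))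
    (g : α → E) (hg : ∀ a, g a ∈ M) : ∫ a, g a ∂μ ∈ M := by
  by_cases hi : Integrable g μ
  swap
  · rw [integral_undef hi]; exact M.zero_mem
  by_contra hx
  have : IsClosed (M : Set E) := hM
  have h1 : ∫ a, M.mkQL (g a) ∂μ = M.mkQL (∫ a, g a ∂μ) :=
    ContinuousLinearMap.integral_comp_comm _ hi
  have h2 : ∀ a, M.mkQL (g a) = 0 := fun a => by simpa using hg a
  simp only [h2, integral_zero] at h1
  exact hx (by simpa using h1.symm)

lemma closed_deriv_mem {𝕜 E : Type*} [RCLike 𝕜] [NormedAddCommGroup E] [NormedSpace 𝕜 E] [NormedSpace ℝ E] [IsScalarTower ℝ 𝕜 E]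
    (M : Submodule 𝕜 E) (hM : IsClosed (M : Set E)) (c : ℝ → E) (c' : E) (r : ℝ)
    (hc : ∀ r, c r ∈ M) (h : HasDerivAt c c' r) : c' ∈ M := by
  have := h.tendsto_slope
  refine hM.mem_of_tendsto this (Eventually.of_forall fun y => ?_)
  simp only [slope, vsub_eq_sub]
  exact (M.restrictScalars ℝ).smul_mem _ (M.sub_mem (hc _) (hc _))

lemma curry_hasDerivAt {X F : Type*} [TopologicalSpace X] [CompactSpace X] [NormedAddCommGroup F] [NormedSpace ℝ F]
    [CompleteSpace F] (G G' : C(ℝ × X, F)) (h : ∀ r x, HasDerivAt (fun s => G (s, x)) (G' (r, x)) r) (r : ℝ) :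
    HasDerivAt (fun s => G.curry s) (G'.curry r) r := by
  have hc : Continuous (fun s => G'.curry s) := G'.curry.continuous
  have key : ∀ s, G.curry s = G.curry 0 + ∫ u in (0:ℝ)..s, G'.curry u := by
    intro s
    ext x
    have h1 : (∫ u in (0:ℝ)..s, G'.curry u) x = ∫ u in (0:ℝ)..s, G'.curry u x := by
      have := (ContinuousMap.evalCLM ℝ x : C(X, F) →L[ℝ] F).intervalIntegral_comp_comm
        (hc.intervalIntegrable 0 s (μ := volume))
      simpa using this.symm
    rw [ContinuousMap.add_apply, h1]
    have h2 : ∫ u in (0:ℝ)..s, G'.curry u x = G.curry s x - G.curry 0 x := by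
      apply intervalIntegral.integral_eq_sub_of_hasDerivAt
      · intro u _; exact h u x
      · apply Continuous.intervalIntegrable
        simp only [ContinuousMap.curry_apply]
        fun_prop
    rw [h2]; abel
  have : (fun s => G.curry s) = fun s => G.curry 0 + ∫ u in (0:ℝ)..s, G'.curry u := funext key
  rw [this]
  exact (intervalIntegral.integral_hasDerivAt_right (hc.intervalIntegrable _ _)
    (hc.stronglyMeasurableAtFilter _ _) hc.continuousAt).const_add _

/-- differentiate a mollification. -/
lemma moll_deriv {G : Type*} [NormedAddCommGroup G] [NormedSpace ℝ G] [FiniteDimensional ℝ G] [MeasurableSpace G]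
    [BorelSpace G] (μ : Measure G) [IsLocallyFiniteMeasure μ] (φ : G → ℝ) (hφ : Continuous φ) (η δ : ℝ)
    (hsupp : ∀ y, y ∉ Metric.closedBall (0:G) η → φ y = 0) (hηδ : η < δ) (h h' : G → ℝ) (z e : G)
    (hh : ContinuousOn h (Metric.closedBall z δ)) (hh' : ContinuousOn h' (Metric.closedBall z δ))
    (hd : ∀ p ∈ Metric.ball z δ, HasLineDerivAt ℝ h (h' p) p e) :
    HasLineDerivAt ℝ (fun z => ∫ y, φ y * h (z - y) ∂μ) (∫ y, φ y * h' (z - y) ∂μ) z e := by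
  have hres : ∀ k : G → ℝ, ∀ z, ∫ y, φ y * k (z - y) ∂μ
      = ∫ y in Metric.closedBall (0:G) η, φ y * k (z - y) ∂μ := by
    intro k z
    rw [setIntegral_eq_integral_of_forall_compl_eq_zero]
    intro y hy; rw [hsupp y hy, zero_mul]
  unfold HasLineDerivAt
  simp only [hres]
  set B := Metric.closedBall (0:G) η
  have hBc : IsCompact B := isCompact_closedBall _ _
  obtain ⟨r, hr, hre⟩ : ∃ r > 0, r * ‖e‖ + η < δ := by
    refine ⟨(δ - η) / (2 * (‖e‖ + 1)), by have := norm_nonneg e; have : 0 < δ - η := by linarith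
                                          positivity, ?_⟩
    have h0 := norm_nonneg e
    have h1 : (δ - η) / (2 * (‖e‖ + 1)) * ‖e‖ ≤ (δ - η) / 2 := by
      rw [div_mul_eq_mul_div, div_le_div_iff₀ (by positivity) (by positivity)]
      nlinarith
    linarith
  have hin : ∀ x ∈ Metric.ball (0:ℝ) r, ∀ y ∈ B, z + x • e - y ∈ Metric.ball z δ := by
    intro x hx y hy
    simp only [B, Metric.mem_ball, Metric.mem_closedBall, dist_eq_norm, sub_zero] at hx hy ⊢
    have : z + x • e - y - z = x • e - y := by abel
    rw [this]
    calc _ ≤ ‖x • e‖ + ‖y‖ := norm_sub_le _ _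
      _ ≤ r * ‖e‖ + η := by rw [norm_smul]; gcongr
      _ < δ := hre
  obtain ⟨C, hC⟩ := (isCompact_closedBall z δ).exists_bound_of_continuousOn hh'
  have hcont : ∀ k : G → ℝ, ContinuousOn k (Metric.closedBall z δ) → ∀ x ∈ Metric.ball (0:ℝ) r,
      ContinuousOn (fun y => φ y * k (z + x • e - y)) B := by
    intro k hk x hx
    refine hφ.continuousOn.mul (hk.comp (by fun_prop) ?_)
    intro y hy
    exact Metric.ball_subset_closedBall (hin x hx y hy)
  have h0 : (0:ℝ) ∈ Metric.ball (0:ℝ) r := Metric.mem_ball_self hr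
  have := hasDerivAt_integral_of_dominated_loc_of_deriv_le (μ := μ.restrict B) (s := Metric.ball (0:ℝ) r)
    (F := fun x y => φ y * h (z + x • e - y)) (F' := fun x y => φ y * h' (z + x • e - y)) (x₀ := (0:ℝ))
    (bound := fun y => ‖φ y‖ * C) (Metric.ball_mem_nhds _ hr)
    ?_ ?_ ?_ ?_ ?_ ?_
  · simpa using this.2
  · filter_upwards [Metric.ball_mem_nhds _ hr] with x hx
    exact (hcont h hh x hx).aestronglyMeasurable hBc.measurableSet
  · exact (hcont h hh 0 h0).integrableOn_compact hBc
  · exact (hcont h' hh' 0 h0).aestronglyMeasurable hBc.measurableSet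
  · filter_upwards [ae_restrict_mem hBc.measurableSet] with y hy x hx
    rw [norm_mul]
    exact mul_le_mul_of_nonneg_left (hC _ (Metric.ball_subset_closedBall (hin x hx y hy))) (norm_nonneg _)
  · exact ((by fun_prop : Continuous fun y => ‖φ y‖ * C)).continuousOn.integrableOn_compact hBc
  · filter_upwards [ae_restrict_mem hBc.measurableSet] with y hy x hx
    apply HasDerivAt.const_mul
    have h1 := hd _ (hin x hx y hy)
    have h2 : HasDerivAt (fun s : ℝ => s - x) 1 x := (hasDerivAt_id x).sub_const x
    have h3 : HasDerivAt (fun t => h (z + x • e - y + t • e)) (h' (z + x • e - y)) ((fun s : ℝ => s - x) x) := by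
      simp only [sub_self]; exact h1
    have h4 := HasDerivAt.comp (h := fun s : ℝ => s - x) x h3 h2
    rw [mul_one] at h4
    convert h4 using 2 with s
    simp only [Function.comp]
    congr 1
    rw [sub_smul]; abel
end

section
open Real MeasureTheory Set Filter

lemma poly_antideriv (P : Polynomial ℝ) (k : ℕ) (hP : P.degree < k) :
    ∃ Q : Polynomial ℝ, Q.degree < (k + 1 : ℕ) ∧ Q.derivative = P := by
  refine ⟨∑ i ∈ Finset.range k, Polynomial.monomial (i + 1) (P.coeff i / (i + 1)), ?_, ?_⟩
  · refine (Polynomial.degree_sum_le _ _).trans_lt ?_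
    rw [Finset.sup_lt_iff (WithBot.bot_lt_coe _)]
    intro i hi
    refine (Polynomial.degree_monomial_le _ _).trans_lt ?_
    have := Finset.mem_range.1 hi
    exact_mod_cast Nat.succ_lt_succ this
  · rw [Polynomial.derivative_sum]
    have h : P.natDegree < k ∨ P = 0 := by
      by_cases h0 : P = 0
      · exact Or.inr h0
      · left; exact (Polynomial.natDegree_lt_iff_degree_lt h0).2 hP
    rcases h with h | h
    · conv_rhs => rw [P.as_sum_range' k h]
      refine Finset.sum_congr rfl fun i _ => ?_
      rw [Polynomial.derivative_monomial]
      congr 1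
      push_cast
      field_simp
    · subst h; simp

lemma poly_of_iter (k : ℕ) : ∀ S : ℝ → ℝ, ContDiff ℝ (⊤ : ℕ∞) S → (∀ x, iteratedDeriv k S x = 0) →
    ∃ P : Polynomial ℝ, P.degree < k ∧ ∀ x, S x = P.eval x := by
  induction k with
  | zero => intro S _ h; exact ⟨0, by simp, by simpa using h⟩
  | succ k ih =>
    intro S hS h
    have hd : ContDiff ℝ (⊤ : ℕ∞) (deriv S) := (contDiff_infty_iff_deriv.1 hS).2
    obtain ⟨P, hP, hP'⟩ := ih (deriv S) hd (by simpa [iteratedDeriv_succ'] using h)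
    obtain ⟨Q, hQ, hQ'⟩ := poly_antideriv P k hP
    have hSd : Differentiable ℝ S := hS.differentiable (by simp)
    refine ⟨Q + Polynomial.C (S 0 - Q.eval 0), ?_, ?_⟩
    · refine (Polynomial.degree_add_le _ _).trans_lt (max_lt hQ ?_)
      exact Polynomial.degree_C_le.trans_lt (by exact_mod_cast Nat.succ_pos k)
    · intro x
      have : ∀ y, HasDerivAt (fun y => S y - Q.eval y) 0 y := by
        intro y
        have h1 := (hSd y).hasDerivAt.sub (Q.hasDerivAt y)
        rwa [hQ', hP' y, sub_self] at h1
      have h2 := is_const_of_deriv_eq_zero (fun y => (this y).differentiableAt)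
        (fun y => (this y).deriv) x 0
      simp only [Polynomial.eval_add, Polynomial.eval_C]
      linarith

/-- mollification -/
noncomputable def moll (φ σ : ℝ → ℝ) : ℝ → ℝ := fun x => ∫ y, φ y * σ (x - y)

lemma moll_contDiff (φ : ContDiffBump (0:ℝ)) (σ : ℝ → ℝ) (hσ : Continuous σ) :
    ContDiff ℝ (⊤ : ℕ∞) (moll (φ.normed volume) σ) := by
  have := HasCompactSupport.contDiff_convolution_left (n := ⊤) (ContinuousLinearMap.lsmul ℝ ℝ) (μ := volume)
    φ.hasCompactSupport_normed (φ.contDiff_normed (μ := volume)) hσ.locallyIntegrable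
  exact this

lemma moll_hasDerivAt (φ : ContDiffBump (0:ℝ)) (σ : ℝ → ℝ) (hσ : ContDiff ℝ 1 σ) (x : ℝ) :
    HasDerivAt (moll (φ.normed volume) σ) (moll (φ.normed volume) (deriv σ) x) x := by
  have := moll_deriv volume (φ.normed volume) φ.continuous_normed φ.rOut (φ.rOut + 1) ?_ (by linarith) σ (deriv σ) x 1
    hσ.continuous.continuousOn (hσ.continuous_deriv (by simp)).continuousOn ?_
  · have h1 := this
    unfold HasLineDerivAt at h1
    have h3 : HasDerivAt (fun t => moll (φ.normed volume) σ (x + t)) (moll (φ.normed volume) (deriv σ) x) (x - x) := by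
      simpa [moll] using h1
    have h4 := HasDerivAt.comp (h := fun s : ℝ => s - x) x h3 ((hasDerivAt_id x).sub_const x)
    rw [mul_one] at h4
    refine h4.congr_of_eventuallyEq (Eventually.of_forall fun s => ?_)
    simp
  · intro y hy
    by_contra h
    have : y ∈ Function.support (φ.normed volume) := h
    rw [φ.support_normed_eq] at this
    exact hy (Metric.ball_subset_closedBall this)
  · intro p _
    have h := ((hσ.differentiable (by simp)) p).hasDerivAt
    unfold HasLineDerivAt
    have h1 := HasDerivAt.comp (h := fun s : ℝ => p + s • (1:ℝ)) (h' := 1) (0:ℝ) (h₂ := σ) (h₂' := deriv σ p) (by simpa using h)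
      (by simpa using (hasDerivAt_id (0:ℝ)).const_add p)
    simpa [Function.comp_def] using h1

lemma exists_moll_ne (σ : ℝ → ℝ) (hσ : Continuous σ)
    (hnp : ¬ ∃ p : Polynomial ℝ, ∀ y : ℝ, σ y = Polynomial.eval y p) (k : ℕ) :
    ∃ (φ : ContDiffBump (0:ℝ)) (θ : ℝ), iteratedDeriv k (moll (φ.normed volume) σ) θ ≠ 0 := by
  by_contra! hcon
  apply hnp
  have hφ : ∀ n : ℕ, ∃ φ : ContDiffBump (0:ℝ), φ.rOut = 2 / ((n:ℝ) + 1) := fun n =>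
    ⟨⟨1 / ((n:ℝ) + 1), 2 / ((n:ℝ) + 1), by positivity, by gcongr; norm_num⟩, rfl⟩
  choose φ hφ using hφ
  have hlim : Tendsto (fun n => (φ n).rOut) atTop (nhds 0) := by
    simp only [hφ]
    have := (tendsto_one_div_add_atTop_nhds_zero_nat (𝕜 := ℝ)).const_mul 2
    simpa [div_eq_mul_inv] using this
  have hpt : ∀ x, Tendsto (fun n => moll ((φ n).normed volume) σ x) atTop (nhds (σ x)) := fun x =>
    ContDiffBump.convolution_tendsto_right_of_continuous (μ := volume) hlim hσ x
  choose P hP hP' using fun n => poly_of_iter k _ (moll_contDiff (φ n) σ hσ) (hcon (φ n))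
  let v : ℕ → ℝ := fun i => (i : ℝ)
  have hv : Set.InjOn v (Finset.range k) := fun a _ b _ h => by simpa [v] using h
  refine ⟨Lagrange.interpolate (Finset.range k) v (fun i => σ (v i)), fun y => ?_⟩
  refine tendsto_nhds_unique (hpt y) ?_
  have h1 : ∀ n, moll ((φ n).normed volume) σ y = (Lagrange.interpolate (Finset.range k) v
      (fun i => moll ((φ n).normed volume) σ (v i))).eval y := by
    intro n
    rw [hP' n y]
    congr 1
    exact Lagrange.eq_interpolate_of_eval_eq _ hv (by simpa using hP n) (fun i _ => (hP' n _).symm)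
  simp only [h1, Lagrange.interpolate_apply, Polynomial.eval_finsetSum, Polynomial.eval_mul, Polynomial.eval_C]
  exact tendsto_finsetSum _ fun i _ => (hpt _).mul_const _
end

section
open Real MeasureTheory Set Filter

/-- lift a jointly continuous real family to a curve of complex-valued continuous maps -/
noncomputable def liftC {X : Type*} [TopologicalSpace X] (g : ℝ × X → ℝ) (hg : Continuous g) : C(ℝ × X, ℂ) :=
  ⟨fun p => (g p : ℂ), by fun_prop⟩

abbrev E1 (X : Type*) [TopologicalSpace X] := C(X, ℂ) × C(X, ℂ) × C(X, ℂ)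

noncomputable def jet3 (R : ℝ) (s0 s1 s2 : ℝ → ℝ) (h0 : Continuous s0) (h1 : Continuous s1) (h2 : Continuous s2)
    (a θ : ℝ) : E1 (Icc (-R) R) :=
  (⟨fun y => ((s0 (a * y + θ) : ℝ) : ℂ), by fun_prop⟩,
   ⟨fun y => ((a * s1 (a * y + θ) : ℝ) : ℂ), by fun_prop⟩,
   ⟨fun y => ((a ^ 2 * s2 (a * y + θ) : ℝ) : ℂ), by fun_prop⟩)

lemma jet3_continuous (R : ℝ) (s0 s1 s2 : ℝ → ℝ) (h0 : Continuous s0) (h1 : Continuous s1) (h2 : Continuous s2)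
    (a θ : ℝ) : Continuous (fun s => jet3 R s0 s1 s2 h0 h1 h2 a (θ - s)) := by
  refine Continuous.prodMk ?_ (Continuous.prodMk ?_ ?_)
  · exact (liftC (X := Icc (-R) R) (fun p => s0 (a * p.2 + (θ - p.1))) (by fun_prop)).curry.continuous
  · exact (liftC (X := Icc (-R) R) (fun p => a * s1 (a * p.2 + (θ - p.1))) (by fun_prop)).curry.continuous
  · exact (liftC (X := Icc (-R) R) (fun p => a ^ 2 * s2 (a * p.2 + (θ - p.1))) (by fun_prop)).curry.continuous

lemma moll_jet_mem (R : ℝ) (s0 s1 s2 : ℝ → ℝ) (h0 : Continuous s0) (h1 : Continuous s1) (h2 : Continuous s2)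
    (M : Submodule ℂ (E1 (Icc (-R) R))) (hM : IsClosed (M : Set (E1 (Icc (-R) R))))
    (hmem : ∀ a θ, jet3 R s0 s1 s2 h0 h1 h2 a θ ∈ M) (φ : ContDiffBump (0:ℝ)) (a θ : ℝ) :
    jet3 R _ _ _ (moll_contDiff φ s0 h0).continuous (moll_contDiff φ s1 h1).continuous
      (moll_contDiff φ s2 h2).continuous a θ ∈ M := by
  set ρ := φ.normed volume with hρ
  have hρc : Continuous ρ := φ.continuous_normed
  have key : ∫ s, ((ρ s : ℝ) : ℂ) • jet3 R s0 s1 s2 h0 h1 h2 a (θ - s) ∈ M :=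
    closed_integral_mem (𝕜 := ℂ) (μ := volume) M hM (fun s => ((ρ s : ℝ) : ℂ) • jet3 R s0 s1 s2 h0 h1 h2 a (θ - s))
      (fun s => M.smul_mem ((ρ s : ℝ) : ℂ) (hmem a (θ - s)))
  have hIntg : Integrable (fun s => ((ρ s : ℝ) : ℂ) • jet3 R s0 s1 s2 h0 h1 h2 a (θ - s)) := by
    apply Continuous.integrable_of_hasCompactSupport
    · exact (Complex.continuous_ofReal.comp hρc).smul (jet3_continuous R s0 s1 s2 h0 h1 h2 a θ)
    · refine (φ.hasCompactSupport_normed (μ := volume)).mono ?_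
      intro s hs
      rw [Function.mem_support] at hs ⊢
      intro h
      exact hs (by rw [hρ, h, Complex.ofReal_zero]; exact zero_smul ℂ (jet3 R s0 s1 s2 h0 h1 h2 a (θ - s)))
  convert key using 1
  have hev : ∀ (L : E1 (Icc (-R) R) →L[ℝ] C(Icc (-R) R, ℂ)) y,
      (L (∫ s, ((ρ s : ℝ) : ℂ) • jet3 R s0 s1 s2 h0 h1 h2 a (θ - s))) y
      = ∫ s, (L (((ρ s : ℝ) : ℂ) • jet3 R s0 s1 s2 h0 h1 h2 a (θ - s))) y := by
    intro L y
    exact (((ContinuousMap.evalCLM ℝ y : C(Icc (-R) R, ℂ) →L[ℝ] ℂ).comp L).integral_comp_comm hIntg).symm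
  refine Prod.ext ?_ (Prod.ext ?_ ?_)
  · ext y
    refine Eq.trans ?_ (hev (ContinuousLinearMap.fst ℝ _ _) y).symm
    simp only [jet3, moll, ContinuousMap.coe_mk, ContinuousLinearMap.coe_fst', Prod.smul_fst, ContinuousMap.smul_apply, smul_eq_mul, ← Complex.ofReal_mul]
    rw [integral_complex_ofReal]
    simp only [add_sub_assoc, hρ]
  · ext y
    refine Eq.trans ?_ (hev ((ContinuousLinearMap.fst ℝ _ _).comp (ContinuousLinearMap.snd ℝ _ _)) y).symm
    simp only [jet3, moll, ContinuousMap.coe_mk, ContinuousLinearMap.coe_fst', ContinuousLinearMap.coe_snd', ContinuousLinearMap.comp_apply, Prod.smul_fst, Prod.smul_snd, ContinuousMap.smul_apply, smul_eq_mul, ← Complex.ofReal_mul]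
    rw [integral_complex_ofReal, ← integral_const_mul]
    simp only [add_sub_assoc, hρ, mul_left_comm]
  · ext y
    refine Eq.trans ?_ (hev ((ContinuousLinearMap.snd ℝ _ _).comp (ContinuousLinearMap.snd ℝ _ _)) y).symm
    simp only [jet3, moll, ContinuousMap.coe_mk, ContinuousLinearMap.coe_snd', ContinuousLinearMap.comp_apply, Prod.smul_snd, ContinuousMap.smul_apply, smul_eq_mul, ← Complex.ofReal_mul]
    rw [integral_complex_ofReal, ← integral_const_mul]
    simp only [add_sub_assoc, hρ, mul_left_comm]

lemma iter_cont (S : ℝ → ℝ) (hS : ContDiff ℝ (⊤ : ℕ∞) S) (k : ℕ) : Continuous (iteratedDeriv k S) :=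
  hS.continuous_iteratedDeriv k (by exact_mod_cast le_top)

lemma iter_deriv (S : ℝ → ℝ) (hS : ContDiff ℝ (⊤ : ℕ∞) S) (k : ℕ) (x : ℝ) :
    HasDerivAt (iteratedDeriv k S) (iteratedDeriv (k + 1) S x) x := by
  rw [iteratedDeriv_succ]
  exact (hS.differentiable_iteratedDeriv k (by exact_mod_cast WithTop.coe_lt_top _) x).hasDerivAt

noncomputable def trip (R : ℝ) (S : ℝ → ℝ) (hS : ContDiff ℝ (⊤ : ℕ∞) S) (θ : ℝ) (k : ℕ) (r : ℝ) : E1 (Icc (-R) R) :=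
  have c0 := iter_cont S hS k
  have c1 := iter_cont S hS (k + 1)
  have c2 := iter_cont S hS (k + 2)
  ((liftC (fun p : ℝ × Icc (-R) R => (p.2 : ℝ) ^ k * iteratedDeriv k S (p.1 * p.2 + θ)) (by fun_prop)).curry r,
   (liftC (fun p : ℝ × Icc (-R) R => k * (p.2 : ℝ) ^ (k - 1) * iteratedDeriv k S (p.1 * p.2 + θ)
      + p.1 * (p.2 : ℝ) ^ k * iteratedDeriv (k + 1) S (p.1 * p.2 + θ)) (by fun_prop)).curry r,
   (liftC (fun p : ℝ × Icc (-R) R => k * (k - 1 : ℝ) * (p.2 : ℝ) ^ (k - 2) * iteratedDeriv k S (p.1 * p.2 + θ)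
      + 2 * k * p.1 * (p.2 : ℝ) ^ (k - 1) * iteratedDeriv (k + 1) S (p.1 * p.2 + θ)
      + p.1 ^ 2 * (p.2 : ℝ) ^ k * iteratedDeriv (k + 2) S (p.1 * p.2 + θ)) (by fun_prop)).curry r)

lemma trip_deriv (R : ℝ) (S : ℝ → ℝ) (hS : ContDiff ℝ (⊤ : ℕ∞) S) (θ : ℝ) (k : ℕ) (r : ℝ) :
    HasDerivAt (trip R S hS θ k) (trip R S hS θ (k + 1) r) r := by
  have hd : ∀ (j : ℕ) (y r : ℝ), HasDerivAt (fun s => iteratedDeriv j S (s * y + θ))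
      (iteratedDeriv (j + 1) S (r * y + θ) * y) r := by
    intro j y r
    have h1 : HasDerivAt (fun s : ℝ => s * y + θ) y r := by
      simpa using ((hasDerivAt_id r).mul_const y).add_const θ
    exact HasDerivAt.comp (h := fun s : ℝ => s * y + θ) r (iter_deriv S hS j _) h1
  refine HasDerivAt.prodMk ?_ (HasDerivAt.prodMk ?_ ?_)
  · refine curry_hasDerivAt _ _ ?_ r
    intro r y
    refine HasDerivAt.ofReal_comp ?_
    refine ((hd k y r).const_mul ((y:ℝ) ^ k)).congr_deriv ?_
    simp only [pow_succ]; ring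
  · refine curry_hasDerivAt _ _ ?_ r
    intro r y
    refine HasDerivAt.ofReal_comp ?_
    refine (((hd k y r).const_mul (k * (y:ℝ) ^ (k - 1))).add
      ((((hasDerivAt_id r).mul_const ((y:ℝ) ^ k))).mul (hd (k + 1) y r))).congr_deriv ?_
    rcases k with _ | k
    · simp only [id]; norm_num; ring
    · simp only [id, Nat.add_sub_cancel, pow_succ]; push_cast; ring
  · refine curry_hasDerivAt _ _ ?_ r
    intro r y
    refine HasDerivAt.ofReal_comp ?_
    refine ((((hd k y r).const_mul (k * (k - 1 : ℝ) * (y:ℝ) ^ (k - 2))).add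
      ((((hasDerivAt_id r).const_mul (2 * k : ℝ)).mul_const ((y:ℝ) ^ (k - 1))).mul (hd (k + 1) y r))).add
      ((((hasDerivAt_id r).pow 2).mul_const ((y:ℝ) ^ k)).mul (hd (k + 2) y r))).congr_deriv ?_
    rcases k with _ | _ | k
    · simp only [id, Pi.pow_apply]; norm_num; ring
    · simp only [id, Pi.pow_apply]; norm_num; ring
    · simp only [id, Pi.pow_apply, show k + 1 + 1 + 1 - 2 = k + 1 by omega, show k + 1 + 1 - 2 = k by omega,
        Nat.add_sub_cancel, pow_succ]; push_cast; ring

noncomputable def powjet (R : ℝ) (k : ℕ) : E1 (Icc (-R) R) :=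
  (⟨fun y => ((y : ℝ) : ℂ) ^ k, by fun_prop⟩,
   ⟨fun y => k * ((y : ℝ) : ℂ) ^ (k - 1), by fun_prop⟩,
   ⟨fun y => k * (k - 1) * ((y : ℝ) : ℂ) ^ (k - 2), by fun_prop⟩)

lemma powjet_mem (R : ℝ) (σ : ℝ → ℝ) (hσ : ContDiff ℝ 2 σ) (h0 : Continuous σ) (h1 : Continuous (deriv σ))
    (h2 : Continuous (deriv (deriv σ)))
    (hnp : ¬ ∃ p : Polynomial ℝ, ∀ y : ℝ, σ y = Polynomial.eval y p)
    (M : Submodule ℂ (E1 (Icc (-R) R))) (hM : IsClosed (M : Set (E1 (Icc (-R) R))))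
    (hmem : ∀ a θ, jet3 R σ (deriv σ) (deriv (deriv σ)) h0 h1 h2 a θ ∈ M) (k : ℕ) : powjet R k ∈ M := by
  obtain ⟨φ, θ, hne⟩ := exists_moll_ne σ h0 hnp k
  have hS := moll_contDiff φ σ h0
  set S := moll (φ.normed volume) σ with hSdef
  have hall : ∀ j r, trip R S hS θ j r ∈ M := by
    intro j
    induction j with
    | zero =>
      intro r
      convert moll_jet_mem R _ _ _ h0 h1 h2 M hM hmem φ r θ using 1
      have e1 : iteratedDeriv 1 S = moll (φ.normed volume) (deriv σ) := by
        rw [iteratedDeriv_one]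
        ext x
        exact (moll_hasDerivAt φ σ (hσ.of_le (by norm_num)) x).deriv
      have e2 : iteratedDeriv 2 S = moll (φ.normed volume) (deriv (deriv σ)) := by
        rw [iteratedDeriv_succ, e1]
        ext x
        refine (moll_hasDerivAt φ (deriv σ) ?_ x).deriv
        exact ((contDiff_succ_iff_deriv (n := 1)).1 (by simpa [one_add_one_eq_two] using hσ)).2.2
      refine Prod.ext ?_ (Prod.ext ?_ ?_)
      · ext y; simp [trip, jet3, liftC, hSdef]
      · ext y; simp [trip, jet3, liftC, e1, ← iteratedDeriv_one]
      · ext y; simp [trip, jet3, liftC, e2]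
    | succ j ih =>
      intro r
      exact closed_deriv_mem M hM _ _ r ih (trip_deriv R S hS θ j r)
  have h := M.smul_mem (((iteratedDeriv k S θ : ℝ) : ℂ)⁻¹) (hall k 0)
  have hne' : ((iteratedDeriv k S θ : ℝ) : ℂ) ≠ 0 := by exact_mod_cast hne
  convert h using 1
  refine Prod.ext ?_ (Prod.ext ?_ ?_)
  · ext y; simp [trip, powjet, liftC]; field_simp
  · ext y; simp [trip, powjet, liftC]; field_simp
  · ext y; simp [trip, powjet, liftC]; field_simp

noncomputable def expjet (R : ℝ) : E1 (Icc (-R) R) :=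
  (⟨fun y => Complex.exp (Complex.I * ((y : ℝ) : ℂ)), by fun_prop⟩,
   ⟨fun y => Complex.I * Complex.exp (Complex.I * ((y : ℝ) : ℂ)), by fun_prop⟩,
   ⟨fun y => - Complex.exp (Complex.I * ((y : ℝ) : ℂ)), by fun_prop⟩)

lemma expjet_mem (R : ℝ) (M : Submodule ℂ (E1 (Icc (-R) R))) (hM : IsClosed (M : Set (E1 (Icc (-R) R))))
    (hmem : ∀ k, powjet R k ∈ M) : expjet R ∈ M := by
  let X : C(Icc (-R) R, ℂ) := ⟨fun y => Complex.I * ((y : ℝ) : ℂ), by fun_prop⟩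
  let e : C(Icc (-R) R, ℂ) := ⟨fun y => Complex.exp (Complex.I * ((y : ℝ) : ℂ)), by fun_prop⟩
  have he : NormedSpace.exp X = e := by
    ext y
    have h1 := NormedSpace.map_exp (ContinuousMap.evalAlgHom ℂ ℂ y : C(Icc (-R) R, ℂ) →ₐ[ℂ] ℂ)
      (by exact continuous_eval_const y) X
    have h2 : NormedSpace.exp X y = NormedSpace.exp (X y) := h1
    rw [h2, ← Complex.exp_eq_exp_ℂ]; rfl
  let P : ℕ → C(Icc (-R) R, ℂ) := fun n => ∑ k ∈ Finset.range n, ((k.factorial : ℂ)⁻¹) • X ^ k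
  have hP : Tendsto P atTop (nhds e) := by
    rw [← he]
    exact (NormedSpace.exp_series_hasSum_exp' (𝕂 := ℂ) X).tendsto_sum_nat
  have hmemP : ∀ n, (P (n + 2), Complex.I • P (n + 1), - P n) ∈ M := by
    intro n
    have : (P (n + 2), Complex.I • P (n + 1), - P n)
        = ∑ k ∈ Finset.range (n + 2), (Complex.I ^ k * (k.factorial : ℂ)⁻¹) • powjet R k := by
      refine Prod.ext ?_ (Prod.ext ?_ ?_)
      · ext y
        simp only [P, X, powjet, Prod.fst_sum, Prod.smul_fst, ContinuousMap.sum_apply, ContinuousMap.smul_apply,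
          ContinuousMap.pow_apply, ContinuousMap.coe_mk, smul_eq_mul]
        refine Finset.sum_congr rfl fun k _ => ?_
        rw [mul_pow]; ring
      · ext y
        simp only [P, X, powjet, Prod.fst_sum, Prod.snd_sum, Prod.smul_fst, Prod.smul_snd, ContinuousMap.sum_apply, ContinuousMap.smul_apply,
          ContinuousMap.pow_apply, ContinuousMap.coe_mk, smul_eq_mul]
        rw [Finset.sum_range_succ' _ (n + 1), Finset.mul_sum]
        simp only [Nat.cast_zero, zero_mul, mul_zero, add_zero]
        refine Finset.sum_congr rfl fun k _ => ?_
        rw [mul_pow, Nat.factorial_succ]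
        have : ((k : ℂ) + 1) ≠ 0 := by exact_mod_cast Nat.succ_ne_zero k
        have : ((k.factorial : ℕ) : ℂ) ≠ 0 := by exact_mod_cast Nat.factorial_ne_zero k
        push_cast
        field_simp
        rw [pow_succ]; ring
      · ext y
        simp only [P, X, powjet, Prod.snd_sum, Prod.smul_snd, ContinuousMap.sum_apply, ContinuousMap.smul_apply,
          ContinuousMap.pow_apply, ContinuousMap.coe_mk, smul_eq_mul, ContinuousMap.neg_apply]
        rw [Finset.sum_range_succ' _ (n + 1), Finset.sum_range_succ' _ n, ← Finset.sum_neg_distrib]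
        simp only [Nat.cast_zero, zero_mul, mul_zero, add_zero, zero_add, Nat.cast_one, sub_self]
        refine Finset.sum_congr rfl fun k _ => ?_
        rw [mul_pow, Nat.factorial_succ, Nat.factorial_succ]
        have : ((k : ℂ) + 1) ≠ 0 := by exact_mod_cast Nat.succ_ne_zero k
        have : ((k : ℂ) + 1 + 1) ≠ 0 := by exact_mod_cast Nat.succ_ne_zero (k + 1)
        have : ((k.factorial : ℕ) : ℂ) ≠ 0 := by exact_mod_cast Nat.factorial_ne_zero k
        push_cast
        field_simp
        rw [show k + 2 = k + 1 + 1 by omega, pow_succ, pow_succ]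
        linear_combination (-Complex.I ^ k * (y:ℂ) ^ k * (k + 1)) * Complex.I_sq
    rw [this]
    exact M.sum_mem fun k _ => M.smul_mem _ (hmem k)
  have hlim : Tendsto (fun n => (P (n + 2), Complex.I • P (n + 1), - P n)) atTop (nhds (e, Complex.I • e, -e)) :=
    ((tendsto_add_atTop_iff_nat 2).2 hP).prodMk_nhds
      ((((tendsto_add_atTop_iff_nat 1).2 hP).const_smul Complex.I).prodMk_nhds hP.neg)
  exact hM.mem_of_tendsto hlim (Eventually.of_forall hmemP)

lemma uni_approx (σ : ℝ → ℝ) (hσ : ContDiff ℝ 2 σ)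
    (hnp : ¬ ∃ p : Polynomial ℝ, ∀ y : ℝ, σ y = Polynomial.eval y p) (R ε : ℝ) (hε : 0 < ε) :
    ∃ (n : ℕ) (c : Fin n → ℂ) (a θ : Fin n → ℝ), ∀ y : ℝ, |y| ≤ R →
      ‖(∑ i, c i * ((σ (a i * y + θ i) : ℝ) : ℂ)) - Complex.exp (Complex.I * y)‖ < ε ∧
      ‖(∑ i, c i * ((a i * deriv σ (a i * y + θ i) : ℝ) : ℂ)) - Complex.I * Complex.exp (Complex.I * y)‖ < ε ∧
      ‖(∑ i, c i * ((a i ^ 2 * deriv (deriv σ) (a i * y + θ i) : ℝ) : ℂ)) - - Complex.exp (Complex.I * y)‖ < ε := by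
  have hσ1 : ContDiff ℝ 1 (deriv σ) :=
    ((contDiff_succ_iff_deriv (n := 1)).1 (by simpa [one_add_one_eq_two] using hσ)).2.2
  have h0 : Continuous σ := hσ.continuous
  have h1 : Continuous (deriv σ) := hσ1.continuous
  have h2 : Continuous (deriv (deriv σ)) := hσ1.continuous_deriv (by simp)
  let j : ℝ × ℝ → E1 (Icc (-R) R) := fun p => jet3 R σ (deriv σ) (deriv (deriv σ)) h0 h1 h2 p.1 p.2
  let M := (Submodule.span ℂ (range j)).topologicalClosure
  have hM : IsClosed (M : Set (E1 (Icc (-R) R))) := Submodule.isClosed_topologicalClosure _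
  have hmem : ∀ a θ, jet3 R σ (deriv σ) (deriv (deriv σ)) h0 h1 h2 a θ ∈ M := fun a θ =>
    Submodule.le_topologicalClosure _ (Submodule.subset_span ⟨(a, θ), rfl⟩)
  have hexp : expjet R ∈ M := expjet_mem R M hM (powjet_mem R σ hσ h0 h1 h2 hnp M hM hmem)
  obtain ⟨N, hN, hd⟩ := Metric.mem_closure_iff.1 (show expjet R ∈ closure _ from hexp) ε hε
  obtain ⟨n, c, g, hg⟩ := Submodule.mem_span_set'.1 hN
  choose p hp using fun i => (g i).2
  refine ⟨n, c, fun i => (p i).1, fun i => (p i).2, fun y hy => ?_⟩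
  rw [dist_comm, dist_eq_norm, ← hg] at hd
  simp only [← hp] at hd
  let y' : Icc (-R) R := ⟨y, abs_le.1 hy⟩
  refine ⟨?_, ?_, ?_⟩
  · refine lt_of_le_of_lt ?_ ((norm_fst_le _).trans_lt hd)
    refine le_trans (le_of_eq ?_) (ContinuousMap.norm_coe_le_norm _ y')
    simp [j, jet3, expjet, y', Prod.fst_sum]
  · refine lt_of_le_of_lt ?_ (((norm_fst_le _).trans (norm_snd_le _)).trans_lt hd)
    refine le_trans (le_of_eq ?_) (ContinuousMap.norm_coe_le_norm _ y')
    simp [j, jet3, expjet, y', Prod.fst_sum, Prod.snd_sum]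
  · refine lt_of_le_of_lt ?_ (((norm_snd_le _).trans (norm_snd_le _)).trans_lt hd)
    refine le_trans (le_of_eq ?_) (ContinuousMap.norm_coe_le_norm _ y')
    simp [j, jet3, expjet, y', Prod.snd_sum]
end

section
open Real MeasureTheory Set Filter
open scoped FourierTransform SchwartzMap LineDeriv

abbrev H3 := EuclideanSpace ℝ (Fin 3)

noncomputable def Jr (s0 s1 s2 : ℝ → ℝ) (W : H3) (θ : ℝ) (p : H3) : Fin 5 → ℝ :=
  ![s0 (inner ℝ W p + θ), W 0 * s1 (inner ℝ W p + θ), W 1 * s1 (inner ℝ W p + θ), W 2 * s1 (inner ℝ W p + θ),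
    (W 2) ^ 2 * s2 (inner ℝ W p + θ)]

noncomputable def JrC (K : Set H3) (s0 s1 s2 : ℝ → ℝ) (h0 : Continuous s0) (h1 : Continuous s1) (h2 : Continuous s2)
    (W : H3) (θ : ℝ) : C(K, Fin 5 → ℂ) :=
  ⟨fun p k => ((Jr s0 s1 s2 W θ p k : ℝ) : ℂ), by
    refine continuous_pi fun k => ?_
    refine Complex.continuous_ofReal.comp ?_
    fin_cases k <;> simp [Jr] <;> fun_prop⟩

noncomputable def mvec (w : H3) : Fin 5 → ℂ :=
  ![1, 2 * π * Complex.I * (w 0 : ℝ), 2 * π * Complex.I * (w 1 : ℝ), 2 * π * Complex.I * (w 2 : ℝ),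
    (2 * π * Complex.I * (w 2 : ℝ)) * (2 * π * Complex.I * (w 2 : ℝ))]

lemma mvec_cont : Continuous mvec := by
  refine continuous_pi fun k => ?_
  fin_cases k <;> simp [mvec] <;> fun_prop

lemma mvec_norm (w : H3) : ‖mvec w‖ ≤ 1 + (2 * π) * ‖w‖ + (2 * π) ^ 2 * ‖w‖ ^ 2 := by
  have hw : ∀ i, ‖w i‖ ≤ ‖w‖ := fun i => PiLp.norm_apply_le w i
  have hπ := Real.pi_pos
  have hn := norm_nonneg w
  have h1 : ∀ i, ‖(2 * π * Complex.I * (w i : ℝ) : ℂ)‖ ≤ 2 * π * ‖w‖ := by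
    intro i
    have : ‖(2 * π * Complex.I * (w i : ℝ) : ℂ)‖ = 2 * π * ‖w i‖ := by
      simp [abs_of_pos hπ]
    rw [this]; gcongr; exact hw i
  have e1 : 0 ≤ 2 * π * ‖w‖ := by positivity
  have e2 : 0 ≤ (2 * π) ^ 2 * ‖w‖ ^ 2 := by positivity
  rw [pi_norm_le_iff_of_nonneg (by positivity)]
  intro k
  fin_cases k
  · simp only [mvec, Fin.zero_eta, Matrix.cons_val_zero, norm_one]; linarith
  · exact (h1 0).trans (by linarith)
  · exact (h1 1).trans (by linarith)
  · exact (h1 2).trans (by linarith)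
  · refine le_trans (le_of_eq (norm_mul _ _)) ((mul_le_mul (h1 2) (h1 2) (norm_nonneg _) e1).trans ?_)
    nlinarith

noncomputable def Jexp2 (K : Set H3) : C(H3 × K, Fin 5 → ℂ) :=
  ⟨fun q => Complex.exp (((2 * π * inner ℝ q.1 (q.2 : H3) : ℝ) : ℂ) * Complex.I) • mvec q.1, by
    have := mvec_cont
    fun_prop⟩

lemma Jexp_norm (K : Set H3) [CompactSpace K] (w : H3) :
    ‖(Jexp2 K).curry w‖ ≤ 1 + (2 * π) * ‖w‖ + (2 * π) ^ 2 * ‖w‖ ^ 2 := by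
  rw [ContinuousMap.norm_le _ (by positivity)]
  intro z
  simp only [Jexp2, ContinuousMap.curry_apply, ContinuousMap.coe_mk, norm_smul, Complex.norm_exp_ofReal_mul_I, one_mul]
  exact mvec_norm w

lemma Jexp_mem (K : Set H3) [CompactSpace K] (σ : ℝ → ℝ) (hσ : ContDiff ℝ 2 σ) (h0 : Continuous σ) (h1 : Continuous (deriv σ))
    (h2 : Continuous (deriv (deriv σ)))
    (hnp : ¬ ∃ p : Polynomial ℝ, ∀ y : ℝ, σ y = Polynomial.eval y p)
    (M : Submodule ℂ C(K, Fin 5 → ℂ)) (hM : IsClosed (M : Set C(K, Fin 5 → ℂ)))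
    (hmem : ∀ W θ, JrC K σ (deriv σ) (deriv (deriv σ)) h0 h1 h2 W θ ∈ M) (w : H3) : (Jexp2 K).curry w ∈ M := by
  have hKc : IsCompact K := isCompact_iff_compactSpace.2 inferInstance
  obtain ⟨R, hR⟩ := hKc.exists_bound_of_continuousOn (f := fun z => 2 * π * inner ℝ w z) (by fun_prop)
  rw [← SetLike.mem_coe, ← hM.closure_eq, Metric.mem_closure_iff]
  intro ε hε
  set B := 1 + (2 * π) * ‖w‖ + (2 * π) ^ 2 * ‖w‖ ^ 2 with hB
  have hBpos : 0 < B := by have := Real.pi_pos; positivity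
  obtain ⟨n, c, a, θ, hn⟩ := uni_approx σ hσ hnp R (ε / (2 * B)) (by positivity)
  refine ⟨∑ i, c i • JrC K σ (deriv σ) (deriv (deriv σ)) h0 h1 h2 ((2 * π * a i) • w) (θ i),
    M.sum_mem fun i _ => M.smul_mem _ (hmem _ _), ?_⟩
  rw [dist_comm, dist_eq_norm]
  refine lt_of_le_of_lt ?_ (half_lt_self hε)
  rw [ContinuousMap.norm_le _ (by positivity)]
  intro z
  rw [pi_norm_le_iff_of_nonneg (by positivity)]
  intro k
  obtain ⟨A0, A1, A2⟩ := hn (2 * π * inner ℝ w z) (hR z z.2)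
  have hq : ∀ k, ‖mvec w k‖ ≤ B := fun k => (norm_le_pi_norm _ k).trans (mvec_norm w)
  have hfin : ∀ (k : Fin 5) (d x : ℂ), ‖d‖ < ε / (2 * B) → ‖x‖ = ‖mvec w k‖ * ‖d‖ → ‖x‖ ≤ ε / 2 := by
    intro k d x hd hx
    rw [hx]
    calc _ ≤ B * (ε / (2 * B)) := mul_le_mul (hq k) hd.le (norm_nonneg _) hBpos.le
      _ = ε / 2 := by field_simp
  have hin : ∀ i, inner ℝ ((2 * π * a i) • w) (z : H3) + θ i = a i * (2 * π * inner ℝ w z) + θ i := by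
    intro i; rw [real_inner_smul_left]; ring
  have hexp : Complex.exp (((2 * π * inner ℝ w (z : H3) : ℝ) : ℂ) * Complex.I)
      = Complex.exp (Complex.I * ((2 * π * inner ℝ w (z : H3) : ℝ) : ℂ)) := by rw [mul_comm]
  have hI : ∀ x : ℂ, ‖x‖ = ‖Complex.I * x‖ := by intro x; simp
  simp only [ContinuousMap.sub_apply, ContinuousMap.sum_apply, ContinuousMap.smul_apply, JrC, Jexp2, ContinuousMap.coe_mk,
    Pi.sub_apply, Finset.sum_apply, Pi.smul_apply, smul_eq_mul, ContinuousMap.curry_apply, Jr, hin, hexp]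
  set e := Complex.exp (Complex.I * ((2 * π * inner ℝ w (z : H3) : ℝ) : ℂ)) with he
  set s1 := ∑ i, c i * ((a i * deriv σ (a i * (2 * π * inner ℝ w z) + θ i) : ℝ) : ℂ) with hs1
  set s2 := ∑ i, c i * ((a i ^ 2 * deriv (deriv σ) (a i * (2 * π * inner ℝ w z) + θ i) : ℝ) : ℂ) with hs2
  have hmid : ∀ l : Fin 3, (∑ i, c i * ((((2 * π * a i) • w) l * deriv σ (a i * (2 * π * inner ℝ w z) + θ i) : ℝ) : ℂ))
      = 2 * π * (w l : ℝ) * s1 := by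
    intro l
    rw [hs1, Finset.mul_sum]
    refine Finset.sum_congr rfl fun i _ => ?_
    simp only [PiLp.smul_apply, smul_eq_mul]; push_cast; ring
  have hlast : (∑ i, c i * (((((2 * π * a i) • w) 2) ^ 2 * deriv (deriv σ) (a i * (2 * π * inner ℝ w z) + θ i) : ℝ) : ℂ))
      = (2 * π * (w 2 : ℝ)) ^ 2 * s2 := by
    rw [hs2, Finset.mul_sum]
    refine Finset.sum_congr rfl fun i _ => ?_
    simp only [PiLp.smul_apply, smul_eq_mul]; push_cast; ring
  have hmid' : ∀ l : Fin 3, ‖2 * π * (w l : ℝ) * s1 - e * (2 * π * Complex.I * (w l : ℝ))‖ =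
      ‖(2 * π * Complex.I * (w l : ℝ) : ℂ)‖ * ‖s1 - Complex.I * e‖ := by
    intro l
    rw [← norm_mul, hI]
    congr 1; ring
  fin_cases k
  · refine hfin 0 _ _ A0 ?_
    simp [mvec]
  · refine hfin 1 _ _ A1 ?_
    refine Eq.trans ?_ (hmid' 0)
    rw [← hmid]; rfl
  · refine hfin 2 _ _ A1 ?_
    refine Eq.trans ?_ (hmid' 1)
    rw [← hmid]; rfl
  · refine hfin 3 _ _ A1 ?_
    refine Eq.trans ?_ (hmid' 2)
    rw [← hmid]; rfl
  · refine hfin 4 _ _ A2 ?_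
    have : ‖(2 * π * (w 2 : ℝ)) ^ 2 * s2 - e * ((2 * π * Complex.I * (w 2 : ℝ)) * (2 * π * Complex.I * (w 2 : ℝ)))‖ =
      ‖((2 * π * Complex.I * (w 2 : ℝ)) * (2 * π * Complex.I * (w 2 : ℝ)) : ℂ)‖ * ‖s2 - -e‖ := by
      rw [← norm_mul, ← norm_neg]
      congr 1
      linear_combination (-(2 * π * (w 2 : ℝ)) ^ 2 * s2) * Complex.I_sq
    refine Eq.trans ?_ this
    rw [← hlast]; rfl

/-- derivative vector of a Schwartz function -/
noncomputable def Dvec (u : 𝓢(H3, ℂ)) (p : H3) : Fin 5 → ℂ :=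
  ![u p, (∂_{EuclideanSpace.single (0 : Fin 3) (1:ℝ)} u) p, (∂_{EuclideanSpace.single (1 : Fin 3) (1:ℝ)} u) p,
    (∂_{EuclideanSpace.single (2 : Fin 3) (1:ℝ)} u) p,
    (∂_{EuclideanSpace.single (2 : Fin 3) (1:ℝ)} (∂_{EuclideanSpace.single (2 : Fin 3) (1:ℝ)} u)) p]

lemma fourierInv_formula (g : 𝓢(H3, ℂ)) (p : H3) :
    (𝓕⁻ g) p = ∫ w, Complex.exp (((2 * π * inner ℝ w p : ℝ) : ℂ) * Complex.I) * g w := by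
  rw [SchwartzMap.fourierInv_coe, Real.fourierInv_eq']
  simp

lemma Dvec_formula (u : 𝓢(H3, ℂ)) (p : H3) (k : Fin 5) :
    Dvec u p k = ∫ w, (𝓕 u) w * (Complex.exp (((2 * π * inner ℝ w p : ℝ) : ℂ) * Complex.I) * mvec w k) := by
  have htg : ∀ m : H3, (fun w : H3 => inner ℝ w m).HasTemperateGrowth := fun m => by fun_prop
  have h0 : ∀ v : 𝓢(H3, ℂ), v p = ∫ w, Complex.exp (((2 * π * inner ℝ w p : ℝ) : ℂ) * Complex.I) * (𝓕 v) w := by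
    intro v
    rw [← fourierInv_formula, FourierTransform.fourierInv_fourier_eq]
  have h1 : ∀ (v : 𝓢(H3, ℂ)) (l : Fin 3) w, (𝓕 (∂_{EuclideanSpace.single l (1:ℝ)} v)) w = 2 * π * Complex.I * (w l : ℝ) * (𝓕 v) w := by
    intro v l w
    rw [SchwartzMap.fourier_lineDerivOp_eq, smul_apply, SchwartzMap.smulLeftCLM_apply_apply (htg _)]
    simp [EuclideanSpace.inner_single_right]
    ring
  fin_cases k
  · refine (h0 u).trans (integral_congr_ae (Eventually.of_forall fun w => ?_))
    simp [mvec]; ring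
  · refine (h0 _).trans (integral_congr_ae (Eventually.of_forall fun w => ?_))
    simp [mvec, h1]; ring
  · refine (h0 _).trans (integral_congr_ae (Eventually.of_forall fun w => ?_))
    simp [mvec, h1]; ring
  · refine (h0 _).trans (integral_congr_ae (Eventually.of_forall fun w => ?_))
    simp [mvec, h1]; ring
  · refine (h0 _).trans (integral_congr_ae (Eventually.of_forall fun w => ?_))
    simp [mvec, h1]; ring

lemma net_approx (K : Set H3) (hK : IsCompact K) (σ : ℝ → ℝ) (hσ : ContDiff ℝ 2 σ)
    (hnp : ¬ ∃ p : Polynomial ℝ, ∀ y : ℝ, σ y = Polynomial.eval y p) (u : 𝓢(H3, ℂ)) (ε : ℝ) (hε : 0 < ε) :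
    ∃ (n : ℕ) (c : Fin n → ℂ) (W : Fin n → H3) (θ : Fin n → ℝ), ∀ p ∈ K, ∀ k,
      ‖(∑ i, c i * ((Jr σ (deriv σ) (deriv (deriv σ)) (W i) (θ i) p k : ℝ) : ℂ)) - Dvec u p k‖ < ε := by
  have : CompactSpace K := isCompact_iff_compactSpace.1 hK
  have hσ1 : ContDiff ℝ 1 (deriv σ) :=
    ((contDiff_succ_iff_deriv (n := 1)).1 (by simpa [one_add_one_eq_two] using hσ)).2.2
  have h0 : Continuous σ := hσ.continuous
  have h1 : Continuous (deriv σ) := hσ1.continuous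
  have h2 : Continuous (deriv (deriv σ)) := hσ1.continuous_deriv (by simp)
  let j : H3 × ℝ → C(K, Fin 5 → ℂ) := fun p => JrC K σ (deriv σ) (deriv (deriv σ)) h0 h1 h2 p.1 p.2
  let M := (Submodule.span ℂ (range j)).topologicalClosure
  have hM : IsClosed (M : Set C(K, Fin 5 → ℂ)) := Submodule.isClosed_topologicalClosure _
  have hmem : ∀ W θ, JrC K σ (deriv σ) (deriv (deriv σ)) h0 h1 h2 W θ ∈ M := fun a θ =>
    Submodule.le_topologicalClosure _ (Submodule.subset_span ⟨(a, θ), rfl⟩)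
  have hin : ∫ w, (𝓕 u) w • (Jexp2 K).curry w ∈ M :=
    closed_integral_mem (𝕜 := ℂ) M hM (fun w => (𝓕 u) w • (Jexp2 K).curry w)
      (fun w => M.smul_mem _ (Jexp_mem K σ hσ h0 h1 h2 hnp M hM hmem w))
  have hIntg : Integrable (fun w => (𝓕 u) w • (Jexp2 K).curry w) := by
    have hb : Integrable (fun w : H3 => ‖w‖ ^ 0 * ‖(𝓕 u) w‖ + (2 * π) * (‖w‖ ^ 1 * ‖(𝓕 u) w‖)
        + (2 * π) ^ 2 * (‖w‖ ^ 2 * ‖(𝓕 u) w‖)) :=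
      (((𝓕 u).integrable_pow_mul volume 0).add (((𝓕 u).integrable_pow_mul volume 1).const_mul _)).add
        (((𝓕 u).integrable_pow_mul volume 2).const_mul _)
    refine hb.mono' ((𝓕 u).continuous.smul (Jexp2 K).curry.continuous).aestronglyMeasurable
      (Eventually.of_forall fun w => ?_)
    rw [norm_smul]
    calc _ ≤ ‖(𝓕 u) w‖ * (1 + (2 * π) * ‖w‖ + (2 * π) ^ 2 * ‖w‖ ^ 2) := by
          gcongr; exact Jexp_norm K w
      _ = _ := by ring
  obtain ⟨N, hN, hd⟩ := Metric.mem_closure_iff.1 (show _ ∈ closure _ from hin) ε hε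
  obtain ⟨n, c, g, hg⟩ := Submodule.mem_span_set'.1 hN
  choose q hq using fun i => (g i).2
  refine ⟨n, c, fun i => (q i).1, fun i => (q i).2, fun p hp k => ?_⟩
  rw [dist_comm, dist_eq_norm, ← hg] at hd
  simp only [← hq] at hd
  refine lt_of_le_of_lt ?_ hd
  refine le_trans ?_ (ContinuousMap.norm_coe_le_norm _ (⟨p, hp⟩ : K))
  refine le_trans (le_of_eq ?_) (norm_le_pi_norm _ k)
  have hev : (∫ w, (𝓕 u) w • (Jexp2 K).curry w) (⟨p, hp⟩ : K) k = Dvec u p k := by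
    rw [Dvec_formula]
    refine Eq.trans (((ContinuousLinearMap.proj k : (Fin 5 → ℂ) →L[ℝ] ℂ).comp
      (ContinuousMap.evalCLM ℝ (⟨p, hp⟩ : K) : C(K, Fin 5 → ℂ) →L[ℝ] (Fin 5 → ℂ))).integral_comp_comm hIntg).symm ?_
    rfl
  simp only [ContinuousMap.sub_apply, Pi.sub_apply, hev]
  simp [j, JrC]
end

section
open Real MeasureTheory Set Filter
open scoped FourierTransform SchwartzMap LineDeriv Convolution

lemma Dvec_of_lineDeriv (w : 𝓢(H3, ℂ)) (F F' : H3 → ℝ) (z e : H3)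
    (hw : (w : H3 → ℂ) =ᶠ[nhds z] fun y => (F y : ℂ)) (h : HasLineDerivAt ℝ F (F' z) z e) :
    (∂_{e} w) z = (F' z : ℂ) := by
  rw [SchwartzMap.lineDerivOp_apply_eq_fderiv]
  have h1 : HasLineDerivAt ℝ (w : H3 → ℂ) (fderiv ℝ w z e) z e :=
    (w.differentiable z).hasFDerivAt.hasLineDerivAt e
  have h2 : HasLineDerivAt ℝ (fun y => (F y : ℂ)) (F' z : ℂ) z e := by
    unfold HasLineDerivAt at h ⊢
    exact h.ofReal_comp
  have h3 := h2.congr_of_eventuallyEq hw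
  exact h1.unique h3

lemma smooth_approx (K U : Set H3) (hK : IsCompact K) (hU : IsOpen U) (hKU : K ⊆ U) (h : Fin 5 → H3 → ℝ)
    (hc : ∀ k, ContinuousOn (h k) U)
    (hd : ∀ l : Fin 3, ∀ p ∈ U, HasLineDerivAt ℝ (h 0) (h l.succ.castSucc p) p (EuclideanSpace.single l (1:ℝ)))
    (hd2 : ∀ p ∈ U, HasLineDerivAt ℝ (h 3) (h 4 p) p (EuclideanSpace.single (2 : Fin 3) (1:ℝ)))
    (ε : ℝ) (hε : 0 < ε) :
    ∃ u : 𝓢(H3, ℂ), ∀ p ∈ K, ∀ k, ‖Dvec u p k - (h k p : ℂ)‖ ≤ ε := by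
  obtain ⟨δ, hδ, hδU⟩ := hK.exists_cthickening_subset_open hU hKU
  set K' := Metric.cthickening δ K with hK'
  have hK'c : IsCompact K' := hK.cthickening
  have hKK' : K ⊆ K' := Metric.self_subset_cthickening K
  have huc : ∀ k, ∃ η > 0, ∀ a ∈ K', ∀ b ∈ K', dist a b < η → dist (h k a) (h k b) < ε := by
    intro k
    have := hK'c.uniformContinuousOn_of_continuous ((hc k).mono hδU)
    rw [Metric.uniformContinuousOn_iff] at this
    obtain ⟨η, h1, h2⟩ := this ε hε
    exact ⟨η, h1, h2⟩
  choose η hη hηu using huc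
  obtain ⟨r, hr, hrη, hrδ⟩ : ∃ r > 0, (∀ k, r ≤ η k) ∧ r < δ / 2 := by
    obtain ⟨k0, hk0⟩ := Finite.exists_min η
    refine ⟨min (η k0) (δ / 4), lt_min (hη _) (by positivity), fun k => (min_le_left _ _).trans (hk0 k), ?_⟩
    exact (min_le_right _ _).trans_lt (by linarith)
  let φ : ContDiffBump (0 : H3) := ⟨r / 2, r, by positivity, by linarith⟩
  let H : Fin 5 → H3 → ℝ := fun k => K'.indicator (h k)
  let ψ : H3 → ℝ := φ.normed volume
  let F : Fin 5 → H3 → ℝ := fun k z => ∫ y, ψ y * H k (z - y)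
  have hF : ∀ k, F k = (ψ ⋆[ContinuousLinearMap.lsmul ℝ ℝ, volume] H k) := fun k => rfl
  have hHint : ∀ k, Integrable (H k) := fun k => by
    rw [integrable_indicator_iff hK'c.measurableSet]
    exact ((hc k).mono hδU).integrableOn_compact hK'c
  have hψc : Continuous ψ := φ.continuous_normed
  have hsub : ∀ z ∈ Metric.thickening (δ/2) K, Metric.closedBall z (δ/2) ⊆ K' := by
    intro z hz y hy
    rw [Metric.mem_thickening_iff] at hz
    obtain ⟨x, hx, hxz⟩ := hz
    refine Metric.mem_cthickening_of_dist_le y x δ K hx ?_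
    have := dist_triangle y z x
    rw [Metric.mem_closedBall] at hy
    linarith
  have hline : ∀ a b : Fin 5, ∀ e : H3, (∀ p ∈ U, HasLineDerivAt ℝ (h a) (h b p) p e) →
      ∀ z ∈ Metric.thickening (δ/2) K, HasLineDerivAt ℝ (F a) (F b z) z e := by
    intro a b e hab z hz
    have hs := hsub z hz
    have hcH : ∀ k, ContinuousOn (H k) (Metric.closedBall z (δ/2)) := fun k =>
      ((hc k).mono (hs.trans hδU)).congr fun y hy => indicator_of_mem (hs hy) _
    refine moll_deriv volume ψ hψc r (δ/2) ?_ hrδ (H a) (H b) z e (hcH a) (hcH b) ?_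
    · intro y hy
      by_contra hne
      have : y ∈ Function.support ψ := hne
      have h2 : y ∈ Metric.ball (0:H3) φ.rOut := by
        rw [← φ.support_normed_eq (μ := volume)]; exact this
      exact hy (Metric.ball_subset_closedBall h2)
    · intro p hp
      have hp' := hs (Metric.ball_subset_closedBall hp)
      have e1 : H b p = h b p := indicator_of_mem hp' _
      rw [e1]
      refine (hab p (hδU hp')).congr_of_eventuallyEq ?_
      filter_upwards [Metric.isOpen_ball.mem_nhds hp] with y hy
      exact indicator_of_mem (hs (Metric.ball_subset_closedBall hy)) _
  have hclose : ∀ k, ∀ z ∈ K, |F k z - h k z| ≤ ε := by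
    intro k z hz
    have e1 : H k z = h k z := indicator_of_mem (hKK' hz) _
    rw [← e1, ← Real.dist_eq, hF]
    refine φ.dist_normed_convolution_le (hHint k).aestronglyMeasurable ?_
    intro x hx
    have hxr : dist x z < r := hx
    have hxK : x ∈ K' := Metric.mem_cthickening_of_dist_le x z δ K hz (by linarith)
    have e2 : H k x = h k x := indicator_of_mem hxK _
    rw [e1, e2]
    exact (hηu k x hxK z (hKK' hz) (hxr.trans_le (hrη k))).le
  have hsm : ContDiff ℝ (⊤ : ℕ∞) (F 0) := by
    rw [hF]
    exact HasCompactSupport.contDiff_convolution_left _ φ.hasCompactSupport_normed φ.contDiff_normed (hHint 0).locallyIntegrable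
  have hcs : HasCompactSupport (F 0) := by
    rw [hF]
    exact HasCompactSupport.convolution _ φ.hasCompactSupport_normed
      (HasCompactSupport.intro hK'c fun x hx => indicator_of_notMem hx _)
  have hsm' : ContDiff ℝ (⊤ : ℕ∞) (fun z => (F 0 z : ℂ)) := Complex.ofRealCLM.contDiff.comp hsm
  have hcs' : HasCompactSupport (fun z => (F 0 z : ℂ)) := hcs.comp_left (g := fun x : ℝ => (x : ℂ)) (by simp)
  let u : 𝓢(H3, ℂ) := hcs'.toSchwartzMap hsm'
  have hu : (u : H3 → ℂ) = fun z => (F 0 z : ℂ) := rfl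
  have hu1 : ∀ l : Fin 3, ∀ z ∈ Metric.thickening (δ/2) K,
      (∂_{EuclideanSpace.single l (1:ℝ)} u) z = (F l.succ.castSucc z : ℂ) := by
    intro l z hz
    exact Dvec_of_lineDeriv u (F 0) (F l.succ.castSucc) z _ (by rw [hu]) (hline 0 _ _ (hd l) z hz)
  have hu2 : ∀ z ∈ Metric.thickening (δ/2) K,
      (∂_{EuclideanSpace.single (2 : Fin 3) (1:ℝ)} (∂_{EuclideanSpace.single (2 : Fin 3) (1:ℝ)} u)) z = (F 4 z : ℂ) := by
    intro z hz
    refine Dvec_of_lineDeriv _ (F 3) (F 4) z _ ?_ (hline 3 4 _ hd2 z hz)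
    filter_upwards [Metric.isOpen_thickening.mem_nhds hz] with y hy
    exact hu1 2 y hy
  refine ⟨u, fun p hp k => ?_⟩
  have hp' : p ∈ Metric.thickening (δ/2) K := Metric.self_subset_thickening (by positivity) K hp
  have : Dvec u p k = (F k p : ℂ) := by
    fin_cases k
    · rfl
    · exact hu1 0 p hp'
    · exact hu1 1 p hp'
    · exact hu1 2 p hp'
    · exact hu2 p hp'
  rw [this, ← Complex.ofReal_sub, Complex.norm_real]
  exact hclose k p hp
end

section
open Real MeasureTheory Set Filter

lemma netA (T : ℝ) (f : ℝ → ℝ → ℝ → ℝ)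
    (hreg : ∃ U : Set (ℝ × ℝ × ℝ), IsOpen U ∧ Kset T ⊆ U ∧ IsC112On f U)
    (s : ℝ → ℝ) (hs : ContDiff ℝ 2 s)
    (hnp : ¬ ∃ p : Polynomial ℝ, ∀ y : ℝ, s y = Polynomial.eval y p) (ε : ℝ) (hε : 0 < ε) :
    ∃ (n : ℕ) (c θ : Fin n → ℝ) (w : Fin n → ℝ × ℝ × ℝ), ∀ t x v, (t, x, v) ∈ Kset T →
      |(∑ i, c i * s ((w i).1 * t + (w i).2.1 * x + (w i).2.2 * v + θ i)) - f t x v| < ε ∧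
      |(∑ i, c i * ((w i).1 * deriv s ((w i).1 * t + (w i).2.1 * x + (w i).2.2 * v + θ i))) - Dt f t x v| < ε ∧
      |(∑ i, c i * ((w i).2.1 * deriv s ((w i).1 * t + (w i).2.1 * x + (w i).2.2 * v + θ i))) - Dx f t x v| < ε ∧
      |(∑ i, c i * ((w i).2.2 * deriv s ((w i).1 * t + (w i).2.1 * x + (w i).2.2 * v + θ i))) - Dv f t x v| < ε ∧
      |(∑ i, c i * ((w i).2.2 ^ 2 * deriv (deriv s) ((w i).1 * t + (w i).2.1 * x + (w i).2.2 * v + θ i)))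
        - Dv (Dv f) t x v| < ε := by
  obtain ⟨U, hU, hKU, hC⟩ := hreg
  let q : H3 → ℝ × ℝ × ℝ := fun p => (p 0, p 1, p 2)
  let j : ℝ × ℝ × ℝ → H3 := fun p => !₂[p.1, p.2.1, p.2.2]
  have hq : Continuous q := by fun_prop
  have hj : Continuous j := by
    refine (PiLp.continuous_toLp 2 _).comp (continuous_pi fun k => ?_)
    fin_cases k <;> simp <;> fun_prop
  have hqj : ∀ p, q (j p) = p := fun p => by simp [q, j]
  have hKc : IsCompact (Kset T) := isCompact_Icc.prod (isCompact_Icc.prod isCompact_Icc)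
  let G : Fin 5 → ℝ → ℝ → ℝ → ℝ := ![f, Dt f, Dx f, Dv f, Dv (Dv f)]
  let h : Fin 5 → H3 → ℝ := fun k p => G k (p 0) (p 1) (p 2)
  obtain ⟨hC1, hC2, hC3, hC4⟩ := hC
  have hc : ∀ k, ContinuousOn (h k) (q ⁻¹' U) := by
    intro k p hp
    have key : ∀ g : ℝ → ℝ → ℝ → ℝ, ContinuousAt (fun q : ℝ × ℝ × ℝ => g q.1 q.2.1 q.2.2) (q p) →
      ContinuousWithinAt (fun p : H3 => g (p 0) (p 1) (p 2)) (q ⁻¹' U) p := fun g hg =>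
        (ContinuousAt.comp (f := q) hg hq.continuousAt).continuousWithinAt
    fin_cases k
    · exact key f (hC1 0 0 0 (by norm_num) (by norm_num) (by norm_num) _ hp)
    · exact key (Dt f) (hC1 1 0 0 (by norm_num) (by norm_num) (by norm_num) _ hp)
    · exact key (Dx f) (hC1 0 1 0 (by norm_num) (by norm_num) (by norm_num) _ hp)
    · exact key (Dv f) (hC1 0 0 1 (by norm_num) (by norm_num) (by norm_num) _ hp)
    · exact key (Dv (Dv f)) (hC1 0 0 2 (by norm_num) (by norm_num) (by norm_num) _ hp)
  have hshift : ∀ (g : ℝ → ℝ) (a : ℝ), DifferentiableAt ℝ g a → HasDerivAt (fun τ : ℝ => g (a + τ)) (deriv g a) 0 := by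
    intro g a hg
    have : HasDerivAt g (deriv g a) (a + 0) := by simpa using hg.hasDerivAt
    simpa using this.comp_const_add a 0
  have hd : ∀ l : Fin 3, ∀ p ∈ q ⁻¹' U,
      HasLineDerivAt ℝ (h 0) (h l.succ.castSucc p) p (EuclideanSpace.single l (1:ℝ)) := by
    intro l p hp
    unfold HasLineDerivAt
    fin_cases l
    · refine HasDerivAt.congr_of_eventuallyEq (hshift _ _ (hC2 0 0 (by norm_num) (by norm_num) _ hp)) (Eventually.of_forall fun τ => ?_)
      simp [h, G, q, mixedD]
    · refine HasDerivAt.congr_of_eventuallyEq (hshift _ _ (hC3 0 (by norm_num) _ hp)) (Eventually.of_forall fun τ => ?_)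
      simp [h, G, q, mixedD]
    · refine HasDerivAt.congr_of_eventuallyEq (hshift _ _ (hC4 0 (by norm_num) _ hp)) (Eventually.of_forall fun τ => ?_)
      simp [h, G, q, mixedD]
  have hd2 : ∀ p ∈ q ⁻¹' U, HasLineDerivAt ℝ (h 3) (h 4 p) p (EuclideanSpace.single (2 : Fin 3) (1:ℝ)) := by
    intro p hp
    unfold HasLineDerivAt
    refine HasDerivAt.congr_of_eventuallyEq (hshift _ _ (hC4 1 (by norm_num) _ hp)) (Eventually.of_forall fun τ => ?_)
    simp [h, G, q, mixedD]
  obtain ⟨u, hu⟩ := smooth_approx (j '' Kset T) (q ⁻¹' U) (hKc.image hj) (hU.preimage hq)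
    (by rintro _ ⟨p, hp, rfl⟩; show q (j p) ∈ U; rw [hqj]; exact hKU hp) h hc hd hd2 (ε/2) (by positivity)
  obtain ⟨n, c, W, θ, hn⟩ := net_approx (j '' Kset T) (hKc.image hj) s hs hnp u (ε/2) (by positivity)
  refine ⟨n, fun i => (c i).re, θ, fun i => (W i 0, W i 1, W i 2), fun t x v hp => ?_⟩
  have main : ∀ k, |(∑ i, (c i).re * Jr s (deriv s) (deriv (deriv s)) (W i) (θ i) (j (t,x,v)) k) - G k t x v| < ε := by
    intro k
    have a1 := hu _ (mem_image_of_mem j hp) k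
    have a2 := hn _ (mem_image_of_mem j hp) k
    have a3 : h k (j (t,x,v)) = G k t x v := by simp [h, j]
    rw [a3] at a1
    have a4 := Complex.abs_re_le_norm ((∑ i, c i * ((Jr s (deriv s) (deriv (deriv s)) (W i) (θ i) (j (t,x,v)) k : ℝ) : ℂ)) - (G k t x v : ℂ))
    have a5 : ((∑ i, c i * ((Jr s (deriv s) (deriv (deriv s)) (W i) (θ i) (j (t,x,v)) k : ℝ) : ℂ)) - (G k t x v : ℂ)).re
      = (∑ i, (c i).re * Jr s (deriv s) (deriv (deriv s)) (W i) (θ i) (j (t,x,v)) k) - G k t x v := by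
      simp
    rw [a5] at a4
    refine a4.trans_lt ?_
    have := norm_sub_le_norm_sub_add_norm_sub (∑ i, c i * ((Jr s (deriv s) (deriv (deriv s)) (W i) (θ i) (j (t,x,v)) k : ℝ) : ℂ)) (Dvec u (j (t,x,v)) k) (G k t x v : ℂ)
    linarith
  have hin : ∀ i, inner ℝ (W i) (j (t,x,v)) = W i 0 * t + W i 1 * x + W i 2 * v := by
    intro i
    simp [PiLp.inner_apply, Fin.sum_univ_three, j]
    ring
  have m0 := main 0
  have m1 := main 1
  have m2 := main 2
  have m3 := main 3
  have m4 := main 4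
  simp only [Jr, hin] at m0 m1 m2 m3 m4
  exact ⟨m0, m1, m2, m3, m4⟩
end

noncomputable def netN (s : ℝ → ℝ) {n : ℕ} (c θ : Fin n → ℝ) (w : Fin n → ℝ × ℝ × ℝ) : ℝ → ℝ → ℝ → ℝ :=
  fun t x v => ∑ i, c i * s ((w i).1 * t + (w i).2.1 * x + (w i).2.2 * v + θ i)

lemma sum_hasDerivAt (s : ℝ → ℝ) (hs : Differentiable ℝ s) {n : ℕ} (c a : Fin n → ℝ) (L : Fin n → ℝ → ℝ)
    (y : ℝ) (hL : ∀ i, HasDerivAt (L i) (a i) y) :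
    HasDerivAt (fun y => ∑ i, c i * s (L i y)) (∑ i, c i * (a i * deriv s (L i y))) y := by
  refine HasDerivAt.fun_sum fun i _ => HasDerivAt.const_mul _ ?_
  have := (hs (L i y)).hasDerivAt.comp y (hL i)
  rw [mul_comm]; exact this

lemma net_Dt (s : ℝ → ℝ) (hs : Differentiable ℝ s) {n : ℕ} (c θ : Fin n → ℝ) (w : Fin n → ℝ × ℝ × ℝ) (t x v : ℝ) :
    Dt (netN s c θ w) t x v
      = ∑ i, c i * ((w i).1 * deriv s ((w i).1 * t + (w i).2.1 * x + (w i).2.2 * v + θ i)) := by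
  refine (sum_hasDerivAt s hs c _ _ t fun i => ?_).deriv
  simpa using ((((hasDerivAt_id t).const_mul (w i).1).add_const ((w i).2.1 * x)).add_const ((w i).2.2 * v)).add_const (θ i)

lemma net_Dx (s : ℝ → ℝ) (hs : Differentiable ℝ s) {n : ℕ} (c θ : Fin n → ℝ) (w : Fin n → ℝ × ℝ × ℝ) (t x v : ℝ) :
    Dx (netN s c θ w) t x v
      = ∑ i, c i * ((w i).2.1 * deriv s ((w i).1 * t + (w i).2.1 * x + (w i).2.2 * v + θ i)) := by
  refine (sum_hasDerivAt s hs c _ _ x fun i => ?_).deriv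
  simpa using ((((hasDerivAt_id x).const_mul (w i).2.1).const_add ((w i).1 * t)).add_const ((w i).2.2 * v)).add_const (θ i)

lemma net_hasDv (s : ℝ → ℝ) (hs : Differentiable ℝ s) {n : ℕ} (c θ : Fin n → ℝ) (w : Fin n → ℝ × ℝ × ℝ) (t x v : ℝ) :
    HasDerivAt (fun v => netN s c θ w t x v)
      (∑ i, c i * ((w i).2.2 * deriv s ((w i).1 * t + (w i).2.1 * x + (w i).2.2 * v + θ i))) v := by
  refine sum_hasDerivAt s hs c _ _ v fun i => ?_
  simpa using ((((hasDerivAt_id v).const_mul (w i).2.2).const_add ((w i).1 * t + (w i).2.1 * x))).add_const (θ i)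

lemma net_DvDv (s : ℝ → ℝ) (hs : Differentiable ℝ s) (hs' : Differentiable ℝ (deriv s)) {n : ℕ}
    (c θ : Fin n → ℝ) (w : Fin n → ℝ × ℝ × ℝ) (t x v : ℝ) :
    Dv (Dv (netN s c θ w)) t x v
      = ∑ i, c i * ((w i).2.2 ^ 2 * deriv (deriv s) ((w i).1 * t + (w i).2.1 * x + (w i).2.2 * v + θ i)) := by
  have h1 : Dv (netN s c θ w) = netN (deriv s) (fun i => c i * (w i).2.2) θ w := by
    funext t x v
    refine (net_hasDv s hs c θ w t x v).deriv.trans ?_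
    unfold netN
    exact Finset.sum_congr rfl fun i _ => by ring
  rw [h1]
  refine (net_hasDv (deriv s) hs' _ θ w t x v).deriv.trans ?_
  exact Finset.sum_congr rfl fun i _ => by ring

lemma Dv_mul (u : ℝ → ℝ → ℝ → ℝ) (t x v : ℝ) (h : DifferentiableAt ℝ (fun w => u t x w) v) :
    Dv (fun t' x' w => w * u t' x' w) t x v = u t x v + v * Dv u t x v := by
  have := ((hasDerivAt_id v).fun_mul h.hasDerivAt).deriv
  simpa [Dv] using this

lemma ae_ne (a : ℝ) : ∀ᵐ x : ℝ, x ≠ a := by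
  simp [ae_iff, measure_singleton]

lemma int_bound (F : ℝ → ℝ) (a b C : ℝ) (hab : a ≤ b) (h : ∀ x ∈ Ioo a b, |F x| ≤ C) :
    |∫ x in a..b, F x| ≤ C * (b - a) := by
  have := intervalIntegral.norm_integral_le_of_norm_le_const_ae (a := a) (b := b) (f := F) (C := C) ?_
  · rwa [abs_of_nonneg (sub_nonneg.2 hab)] at this
  · filter_upwards [ae_ne b] with x hx hx2
    rw [uIoc_of_le hab] at hx2
    exact h x ⟨hx2.1, lt_of_le_of_ne hx2.2 hx⟩

lemma loss_bound (σ β T : ℝ) (hσ : 0 < σ) (hβ : 0 ≤ β) (hT : 0 < T)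
    (f : ℝ → ℝ → ℝ → ℝ) (f0 : ℝ → ℝ → ℝ) (g : ℝ → ℝ → ℝ → ℝ)
    (hreg : ∃ U : Set (ℝ × ℝ × ℝ), IsOpen U ∧ Kset T ⊆ U ∧ IsC112On f U)
    (hPDE : ∀ t ∈ Set.Ioo (0 : ℝ) T, ∀ x ∈ Set.Ioo (-1 : ℝ) 1, ∀ v : ℝ,
      Dt f t x v + v * Dx f t x v
        = σ * Dv (Dv f) t x v + β * Dv (fun t' x' w => w * f t' x' w) t x v)
    (hIC : ∀ x ∈ Set.Ioo (-1 : ℝ) 1, ∀ v : ℝ, f 0 x v = f0 x v)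
    (hBC : ∀ t ∈ Set.Icc (0 : ℝ) T,
      (∀ v : ℝ, v < 0 → f t 1 v = g t 1 v) ∧ (∀ v : ℝ, 0 < v → f t (-1) v = g t (-1) v))
    (s : ℝ → ℝ) (hs : ContDiff ℝ 2 s)
    (hnp : ¬ ∃ p : Polynomial ℝ, ∀ y : ℝ, s y = Polynomial.eval y p) (ε : ℝ) (hε : 0 < ε) :
    ∃ (n : ℕ) (c θ : Fin n → ℝ) (w : Fin n → ℝ × ℝ × ℝ),
      |LossGE σ β T (netN s c θ w) + LossIC f0 (netN s c θ w) + LossBCinflow T g (netN s c θ w)|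
        ≤ ((ε * (11 + σ + 11 * β)) ^ 2) * 20 * 2 * T + ε ^ 2 * 20 * 2 + (ε ^ 2 * 10 + ε ^ 2 * 10) * T := by
  obtain ⟨n, c, θ, w, h⟩ := netA T f hreg s hs hnp ε hε
  refine ⟨n, c, θ, w, ?_⟩
  have hs1 : ContDiff ℝ 1 (deriv s) :=
    ((contDiff_succ_iff_deriv (n := 1)).1 (by simpa [one_add_one_eq_two] using hs)).2.2
  have hsd : Differentiable ℝ s := hs.differentiable (by norm_num)
  have hsd' : Differentiable ℝ (deriv s) := hs1.differentiable (by norm_num)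
  obtain ⟨U, hU, hKU, hC1, hC2, hC3, hC4⟩ := hreg
  have hfd : ∀ t x v, (t, x, v) ∈ Kset T → DifferentiableAt ℝ (fun w => f t x w) v := fun t x v hp =>
    hC4 0 (by norm_num) (t, x, v) (hKU hp)
  set N := netN s c θ w with hN
  have hK : ∀ t x v, t ∈ Icc 0 T → x ∈ Icc (-1:ℝ) 1 → v ∈ Icc (-10:ℝ) 10 → (t, x, v) ∈ Kset T :=
    fun t x v ht hx hv => ⟨ht, hx, hv⟩
  have hval : ∀ t x v, (t, x, v) ∈ Kset T → |N t x v - f t x v| < ε := fun t x v hp => (h t x v hp).1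
  have hsq : ∀ a C : ℝ, |a| ≤ C → |a ^ 2| ≤ C ^ 2 := by
    intro a C ha
    rw [abs_pow]
    exact pow_le_pow_left₀ (abs_nonneg a) ha 2
  have hres : ∀ t ∈ Ioo 0 T, ∀ x ∈ Ioo (-1:ℝ) 1, ∀ v ∈ Ioo (-10:ℝ) 10,
      |FPresidual σ β N t x v| ≤ ε * (11 + σ + 11 * β) := by
    intro t ht x hx v hv
    have hp := hK t x v (Ioo_subset_Icc_self ht) (Ioo_subset_Icc_self hx) (Ioo_subset_Icc_self hv)
    obtain ⟨b0, b1, b2, b3, b4⟩ := h t x v hp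
    have d3 := (net_hasDv s hsd c θ w t x v)
    rw [← net_Dt s hsd] at b1
    rw [← net_Dx s hsd] at b2
    rw [← d3.deriv] at b3
    rw [← net_DvDv s hsd hsd'] at b4
    change |Dv N t x v - _| < ε at b3
    change |N t x v - _| < ε at b0
    rw [← hN] at b1 b2 b4
    have e1 := Dv_mul N t x v d3.differentiableAt
    have e2 := Dv_mul f t x v (hfd t x v hp)
    have e3 := hPDE t ht x hx v
    rw [e2] at e3
    unfold FPresidual
    rw [e1]
    have hv' : |v| ≤ 10 := abs_le.2 ⟨hv.1.le, hv.2.le⟩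
    have key : Dt N t x v + v * Dx N t x v - σ * Dv (Dv N) t x v - β * (N t x v + v * Dv N t x v)
      = (Dt N t x v - Dt f t x v) + v * (Dx N t x v - Dx f t x v) - σ * (Dv (Dv N) t x v - Dv (Dv f) t x v)
        - β * ((N t x v - f t x v) + v * (Dv N t x v - Dv f t x v)) := by
      linear_combination e3
    rw [key]
    have m : ∀ a : ℝ, |a| < ε → |v * a| ≤ 10 * ε := fun a ha => by
      rw [abs_mul]; exact mul_le_mul hv' ha.le (abs_nonneg _) (by norm_num)
    have c2 := m _ b2
    have c3 := m _ b3
    have c4 : |σ * (Dv (Dv N) t x v - Dv (Dv f) t x v)| ≤ σ * ε := by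
      rw [abs_mul, abs_of_pos hσ]; gcongr
    have c5 : |β * ((N t x v - f t x v) + v * (Dv N t x v - Dv f t x v))| ≤ β * (ε + 10 * ε) := by
      rw [abs_mul, abs_of_nonneg hβ]
      gcongr
      exact (abs_add_le _ _).trans (add_le_add b0.le c3)
    rw [abs_le] at *
    rw [abs_lt] at b1
    constructor <;> linarith
  have hGE : |LossGE σ β T N| ≤ ((ε * (11 + σ + 11 * β)) ^ 2) * 20 * 2 * T := by
    have := int_bound (fun t => ∫ x in (-1 : ℝ)..(1 : ℝ), ∫ v in (-10 : ℝ)..(10 : ℝ), (FPresidual σ β N t x v) ^ 2)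
      0 T (((ε * (11 + σ + 11 * β)) ^ 2) * 20 * 2) hT.le ?_
    · simpa [LossGE] using this
    intro t ht
    refine (int_bound _ (-1) 1 (((ε * (11 + σ + 11 * β)) ^ 2) * 20) (by norm_num) ?_).trans_eq (by ring)
    intro x hx
    refine (int_bound _ (-10) 10 (((ε * (11 + σ + 11 * β)) ^ 2)) (by norm_num) ?_).trans_eq (by ring)
    intro v hv
    exact hsq _ _ (hres t ht x hx v hv)
  have hICb : |LossIC f0 N| ≤ ε ^ 2 * 20 * 2 := by
    refine (int_bound _ (-1) 1 (ε ^ 2 * 20) (by norm_num) ?_).trans_eq (by ring)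
    intro x hx
    refine (int_bound _ (-10) 10 (ε ^ 2) (by norm_num) ?_).trans_eq (by ring)
    intro v hv
    refine hsq _ _ ?_
    rw [← hIC x hx v]
    exact (hval _ _ _ (hK _ _ _ ⟨le_rfl, hT.le⟩ (Ioo_subset_Icc_self hx) (Ioo_subset_Icc_self hv))).le
  have hBCb : |LossBCinflow T g N| ≤ (ε ^ 2 * 10 + ε ^ 2 * 10) * T := by
    refine (int_bound _ 0 T (ε ^ 2 * 10 + ε ^ 2 * 10) hT.le ?_).trans_eq (by ring)
    intro t ht
    have ht' := Ioo_subset_Icc_self ht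
    refine (abs_add_le _ _).trans (add_le_add ?_ ?_)
    · refine (int_bound _ (-10) 0 (ε ^ 2) (by norm_num) ?_).trans_eq (by ring)
      intro v hv
      refine hsq _ _ ?_
      rw [← (hBC t ht').1 v hv.2]
      exact (hval _ _ _ (hK _ _ _ ht' (by norm_num) ⟨hv.1.le, by linarith [hv.2]⟩)).le
    · refine (int_bound _ 0 10 (ε ^ 2) (by norm_num) ?_).trans_eq (by ring)
      intro v hv
      refine hsq _ _ ?_
      rw [← (hBC t ht').2 v hv.1]
      exact (hval _ _ _ (hK _ _ _ ht' (by norm_num) ⟨by linarith [hv.1], hv.2.le⟩)).le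
  refine (abs_add_le _ _).trans (add_le_add ((abs_add_le _ _).trans (add_le_add hGE hICb)) hBCb)

/-- If the 1D kinetic Fokker–Planck equation with inflow boundary data `g`
admits a solution of class C^{(1,1,2)} on a neighborhood of K = [0,T]×[−1,1]×[−10,10], and
`σbar` is a non-polynomial C³ activation function, then there is a sequence of one-hidden-layer
neural networks whose total loss tends to 0. -/
theorem statement0 (σ β T : ℝ) (hσ : 0 < σ) (hβ : 0 ≤ β) (hT : 0 < T)
    (f : ℝ → ℝ → ℝ → ℝ) (f0 : ℝ → ℝ → ℝ) (g : ℝ → ℝ → ℝ → ℝ)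
    (hreg : ∃ U : Set (ℝ × ℝ × ℝ), IsOpen U ∧ Kset T ⊆ U ∧ IsC112On f U)
    (hPDE : ∀ t ∈ Set.Ioo (0 : ℝ) T, ∀ x ∈ Set.Ioo (-1 : ℝ) 1, ∀ v : ℝ,
      Dt f t x v + v * Dx f t x v
        = σ * Dv (Dv f) t x v + β * Dv (fun t' x' w => w * f t' x' w) t x v)
    (hIC : ∀ x ∈ Set.Ioo (-1 : ℝ) 1, ∀ v : ℝ, f 0 x v = f0 x v)
    (hBC : ∀ t ∈ Set.Icc (0 : ℝ) T,
      (∀ v : ℝ, v < 0 → f t 1 v = g t 1 v) ∧ (∀ v : ℝ, 0 < v → f t (-1) v = g t (-1) v))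
    (σbar : ℝ → ℝ) (hσbar : ContDiff ℝ 3 σbar)
    (hnonpoly : ¬ ∃ p : Polynomial ℝ, ∀ y : ℝ, σbar y = Polynomial.eval y p) :
    ∃ (m : ℕ → ℕ) (c θ : (j : ℕ) → Fin (m j) → ℝ) (w : (j : ℕ) → Fin (m j) → ℝ × ℝ × ℝ),
      Filter.Tendsto (fun j : ℕ =>
        LossGE σ β T (fun t x v =>
          ∑ i, c j i * σbar ((w j i).1 * t + (w j i).2.1 * x + (w j i).2.2 * v + θ j i)) +
        LossIC f0 (fun t x v =>
          ∑ i, c j i * σbar ((w j i).1 * t + (w j i).2.1 * x + (w j i).2.2 * v + θ j i)) +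
        LossBCinflow T g (fun t x v =>
          ∑ i, c j i * σbar ((w j i).1 * t + (w j i).2.1 * x + (w j i).2.2 * v + θ j i)))
        Filter.atTop (nhds 0) := by
  have hs2 : ContDiff ℝ 2 σbar := hσbar.of_le (by norm_num)
  have key := fun j : ℕ => loss_bound σ β T hσ hβ hT f f0 g hreg hPDE hIC hBC σbar hs2 hnonpoly (1 / ((j : ℝ) + 1))
    (by positivity)
  choose m c θ w hb using key
  refine ⟨m, c, θ, w, ?_⟩
  have hlim : Tendsto (fun j : ℕ => 1 / ((j : ℝ) + 1)) atTop (nhds 0) := tendsto_one_div_add_atTop_nhds_zero_nat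
  refine squeeze_zero_norm hb ?_
  have hcont : Continuous fun ε : ℝ => ((ε * (11 + σ + 11 * β)) ^ 2) * 20 * 2 * T + ε ^ 2 * 20 * 2
      + (ε ^ 2 * 10 + ε ^ 2 * 10) * T := by fun_prop
  have h0 := (hcont.tendsto 0).comp hlim
  simpa [Function.comp_def] using h0
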